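/- arXiv:1408.6979 — 2 statements merged into one kernel-verified Lean document; each statement's English description precedes it below -/
import Mathlib

section
/- For every dimension d ≥ 1 and every C₀ ≥ 1 there exist constants c₁ > 0 and C₁ ≥ 1, depending only on d and C₀, with the following property. Let μ be a Radon measure on ℝ^d and B ⊂ ℝ^d a ball with μ(B) > 0 and μ(B) ≤ C₀·μ((1/4)B). If c ≥ 0 and L is an affine line in ℝ^d such that dist_B(μ, c·H^1|_L) ≤ c₁·r(B)·μ(B), then L ∩ (1/2)B ≠ ∅ and C₁^{-1}·μ(B)/r(B) ≤ c ≤ C₁·μ(B)/r(B). -/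
open MeasureTheory Metric
open scoped ENNReal NNReal

/-- `L` is an affine line in `ℝ^d`. -/
def IsLine {d : ℕ} (L : Set (EuclideanSpace ℝ (Fin d))) : Prop :=
  ∃ x v : EuclideanSpace ℝ (Fin d), v ≠ 0 ∧ L = {y | ∃ t : ℝ, y = x + t • v}

/-- `dist_B(σ,ν)`: supremum of `|∫ f dσ − ∫ f dν|` over 1-Lipschitz `f` supported in `B`. -/
noncomputable def distB {d : ℕ} (B : Set (EuclideanSpace ℝ (Fin d)))
    (σ ν : Measure (EuclideanSpace ℝ (Fin d))) : ℝ :=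
  ⨆ f : {f : EuclideanSpace ℝ (Fin d) → ℝ // LipschitzWith 1 f ∧ Function.support f ⊆ B},
    |(∫ x, f.1 x ∂σ) - ∫ x, f.1 x ∂ν|


lemma line_param {d : ℕ} {L : Set (EuclideanSpace ℝ (Fin d))} (hL : IsLine L)
    {p : EuclideanSpace ℝ (Fin d)} (hp : p ∈ L) :
    ∃ φ : ℝ → EuclideanSpace ℝ (Fin d), Isometry φ ∧ φ 0 = p ∧ Set.range φ = L := by
  obtain ⟨a, v, hv, rfl⟩ := hL
  obtain ⟨t₀, rfl⟩ := hp
  have hn : ‖v‖ ≠ 0 := norm_ne_zero_iff.mpr hv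
  refine ⟨fun t => (a + t₀ • v) + (t / ‖v‖) • v, ?_, by simp, ?_⟩
  · refine Isometry.of_dist_eq fun s t => ?_
    rw [dist_add_left, dist_eq_norm, ← sub_smul, norm_smul, ← sub_div, norm_div, norm_norm,
      div_mul_cancel₀ _ hn, Real.dist_eq, Real.norm_eq_abs]
  · ext y
    constructor
    · rintro ⟨t, rfl⟩
      exact ⟨t₀ + t / ‖v‖, by simp only [add_smul, add_assoc]⟩
    · rintro ⟨t, rfl⟩
      refine ⟨(t - t₀) * ‖v‖, ?_⟩
      simp only [mul_div_cancel_right₀ _ hn, sub_smul]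
      abel

lemma restrict_eq_map {d : ℕ} {L : Set (EuclideanSpace ℝ (Fin d))}
    {φ : ℝ → EuclideanSpace ℝ (Fin d)} (hφ : Isometry φ) (hr : Set.range φ = L) :
    (μH[1] : Measure (EuclideanSpace ℝ (Fin d))).restrict L = Measure.map φ volume := by
  rw [← hr, ← hφ.map_hausdorffMeasure (Or.inl zero_le_one), hausdorffMeasure_real]

lemma preimage_sub {d : ℕ} {φ : ℝ → EuclideanSpace ℝ (Fin d)} (hφ : Isometry φ)
    (x : EuclideanSpace ℝ (Fin d)) (r : ℝ) :
    φ ⁻¹' ball x r ⊆ ball 0 (r + dist (φ 0) x) := by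
  intro t ht
  simp only [Set.mem_preimage, mem_ball] at ht ⊢
  rw [← hφ.dist_eq]
  linarith [dist_triangle_right (φ t) (φ 0) x]

lemma int_bound {d : ℕ} (hd : 1 ≤ d) (σ : Measure (EuclideanSpace ℝ (Fin d)))
    {x : EuclideanSpace ℝ (Fin d)} {r : ℝ} (hr : 0 < r) (hσ : σ (ball x r) < ∞)
    {f : EuclideanSpace ℝ (Fin d) → ℝ} (hf : LipschitzWith 1 f)
    (hs : Function.support f ⊆ ball x r) :
    |∫ y, f y ∂σ| ≤ 2 * r * (σ (ball x r)).toReal := by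
  have : Nonempty (Fin d) := ⟨⟨0, hd⟩⟩
  obtain ⟨z, hz⟩ := (NormedSpace.sphere_nonempty (x := x) (r := r)).mpr hr.le
  have hz0 : f z = 0 := by
    by_contra h
    have := hs h
    rw [mem_sphere] at hz
    rw [mem_ball] at this
    linarith
  have h0 : ∀ y, y ∉ ball x r → f y = 0 := fun y hy => by
    by_contra h
    exact hy (hs h)
  rw [← setIntegral_eq_integral_of_forall_compl_eq_zero h0, ← Real.norm_eq_abs]
  refine norm_setIntegral_le_of_norm_le_const hσ fun y hy => ?_
  have h1 := hf.dist_le_mul y z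
  rw [hz0, dist_zero_right] at h1
  have h2 := dist_triangle_right y z x
  rw [mem_sphere] at hz
  rw [mem_ball] at hy
  simp at h1 ⊢
  linarith

lemma le_distB {d : ℕ} (hd : 1 ≤ d) (σ ν : Measure (EuclideanSpace ℝ (Fin d)))
    {x : EuclideanSpace ℝ (Fin d)} {r : ℝ} (hr : 0 < r) (hσ : σ (ball x r) < ∞)
    (hν : ν (ball x r) < ∞)
    {f : EuclideanSpace ℝ (Fin d) → ℝ} (hf : LipschitzWith 1 f)
    (hs : Function.support f ⊆ ball x r) :
    |(∫ y, f y ∂σ) - ∫ y, f y ∂ν| ≤ distB (ball x r) σ ν := by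
  have hb : BddAbove (Set.range fun f : {f : EuclideanSpace ℝ (Fin d) → ℝ //
      LipschitzWith 1 f ∧ Function.support f ⊆ ball x r} =>
      |(∫ x, f.1 x ∂σ) - ∫ x, f.1 x ∂ν|) := by
    refine ⟨2 * r * (σ (ball x r)).toReal + 2 * r * (ν (ball x r)).toReal, ?_⟩
    rintro _ ⟨⟨g, hg, hgs⟩, rfl⟩
    exact (abs_sub _ _).trans
      (add_le_add (int_bound hd σ hr hσ hg hgs) (int_bound hd ν hr hν hg hgs))
  exact le_ciSup hb ⟨f, hf, hs⟩

/-- The tent function of height and radius `ρ` around `x`. -/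
noncomputable def tent {d : ℕ} (x : EuclideanSpace ℝ (Fin d)) (ρ : ℝ)
    (y : EuclideanSpace ℝ (Fin d)) : ℝ := max (ρ - dist y x) 0

lemma tent_lip {d : ℕ} (x : EuclideanSpace ℝ (Fin d)) (ρ : ℝ) : LipschitzWith 1 (tent x ρ) := by
  have h : LipschitzWith 1 (fun y => ρ - dist y x) := by
    refine LipschitzWith.of_dist_le_mul fun a b => ?_
    rw [Real.dist_eq]
    have := abs_dist_sub_le a b x
    rw [abs_sub_comm] at this
    simpa using this
  exact h.max_const 0

lemma tent_supp {d : ℕ} (x : EuclideanSpace ℝ (Fin d)) (ρ : ℝ) :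
    Function.support (tent x ρ) ⊆ ball x ρ := by
  intro y hy
  by_contra h
  rw [mem_ball, not_lt] at h
  exact hy (max_eq_right (by linarith))

lemma tent_nonneg {d : ℕ} (x : EuclideanSpace ℝ (Fin d)) (ρ : ℝ) (y) : 0 ≤ tent x ρ y :=
  le_max_right _ _

lemma tent_le {d : ℕ} (x : EuclideanSpace ℝ (Fin d)) {ρ : ℝ} (hρ : 0 ≤ ρ) (y) :
    tent x ρ y ≤ ρ := max_le (by linarith [dist_nonneg (x := y) (y := x)]) hρ

lemma tent_int_le {d : ℕ} (σ : Measure (EuclideanSpace ℝ (Fin d)))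
    (x : EuclideanSpace ℝ (Fin d)) {ρ : ℝ} (hρ : 0 ≤ ρ) (hσ : σ (ball x ρ) < ∞) :
    ∫ y, tent x ρ y ∂σ ≤ ρ * (σ (ball x ρ)).toReal := by
  have h0 : ∀ y, y ∉ ball x ρ → tent x ρ y = 0 := fun y hy => by
    by_contra h
    exact hy (tent_supp x ρ h)
  rw [← setIntegral_eq_integral_of_forall_compl_eq_zero h0]
  refine (le_abs_self _).trans ?_
  rw [← Real.norm_eq_abs]
  refine norm_setIntegral_le_of_norm_le_const hσ fun y hy => ?_
  rw [Real.norm_eq_abs, abs_of_nonneg (tent_nonneg _ _ _)]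
  exact tent_le x hρ y

lemma tent_integrable {d : ℕ} (σ : Measure (EuclideanSpace ℝ (Fin d)))
    (x : EuclideanSpace ℝ (Fin d)) {ρ : ℝ} (hρ : 0 ≤ ρ) (hσ : σ (ball x ρ) < ∞) :
    Integrable (tent x ρ) σ := by
  rw [← integrableOn_iff_integrable_of_support_subset (tent_supp x ρ)]
  refine Measure.integrableOn_of_bounded (M := ρ) hσ.ne
    (tent_lip x ρ).continuous.aestronglyMeasurable (Filter.Eventually.of_forall fun y => ?_)
  rw [Real.norm_eq_abs, abs_of_nonneg (tent_nonneg _ _ _)]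
  exact tent_le x hρ y

lemma le_tent_int {d : ℕ} (σ : Measure (EuclideanSpace ℝ (Fin d)))
    (x : EuclideanSpace ℝ (Fin d)) {ρ s : ℝ} (hρ : 0 ≤ ρ) (hs : s ≤ ρ)
    (hσ : σ (ball x ρ) < ∞) :
    (ρ - s) * (σ (ball x s)).toReal ≤ ∫ y, tent x ρ y ∂σ := by
  have hi := tent_integrable σ x hρ hσ
  have hfin : σ (ball x s) ≠ ∞ := ((measure_mono (ball_subset_ball hs)).trans_lt hσ).ne
  refine le_trans ?_ (setIntegral_le_integral (s := ball x s) hi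
    (Filter.Eventually.of_forall (tent_nonneg x ρ)))
  have := setIntegral_ge_of_const_le_real (c := ρ - s) measurableSet_ball hfin
    (fun y (hy : y ∈ ball x s) => by
      rw [mem_ball] at hy
      exact (by linarith : ρ - s ≤ ρ - dist y x).trans (le_max_left _ _)) hi.integrableOn
  simpa [measureReal_def, mul_comm] using this

theorem stmt11 {d : ℕ} (hd : 1 ≤ d) (C₀ : ℝ) (hC₀ : 1 ≤ C₀) :
    ∃ c₁ C₁ : ℝ, 0 < c₁ ∧ 1 ≤ C₁ ∧
      ∀ μ : Measure (EuclideanSpace ℝ (Fin d)), IsLocallyFiniteMeasure μ →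
      ∀ (x : EuclideanSpace ℝ (Fin d)) (r : ℝ), 0 < r →
        0 < μ (ball x r) →
        μ (ball x r) ≤ ENNReal.ofReal C₀ * μ (ball x (r / 4)) →
      ∀ c : ℝ, 0 ≤ c → ∀ L : Set (EuclideanSpace ℝ (Fin d)), IsLine L →
        distB (ball x r) μ ((ENNReal.ofReal c) • (μH[1].restrict L)) ≤
          c₁ * r * (μ (ball x r)).toReal →
        (L ∩ ball x (r / 2)).Nonempty ∧
          C₁⁻¹ * (μ (ball x r)).toReal / r ≤ c ∧
          c ≤ C₁ * (μ (ball x r)).toReal / r := by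
  have hC : 0 < C₀ := by linarith
  refine ⟨(8 * C₀)⁻¹, 16 * C₀, by positivity, by linarith, ?_⟩
  intro μ hμ x r hr hpos hdoub c hc L hL hdist
  set ν : Measure (EuclideanSpace ℝ (Fin d)) :=
    (ENNReal.ofReal c) • ((μH[1] : Measure (EuclideanSpace ℝ (Fin d))).restrict L) with hνdef
  have hμB : ∀ s, μ (ball x s) < ∞ := fun s => measure_ball_lt_top
  have hνval : ∀ φ : ℝ → EuclideanSpace ℝ (Fin d), Isometry φ → Set.range φ = L → ∀ s,
      ν (ball x s) = ENNReal.ofReal c * volume (φ ⁻¹' ball x s) := by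
    intro φ hφ hφr s
    rw [hνdef, restrict_eq_map hφ hφr, Measure.smul_apply, smul_eq_mul,
      Measure.map_apply hφ.continuous.measurable measurableSet_ball]
  have hνB : ∀ s, ν (ball x s) < ∞ := by
    intro s
    obtain ⟨p, hp⟩ : L.Nonempty := by
      obtain ⟨a, v, -, rfl⟩ := hL
      exact ⟨a, 0, by simp⟩
    obtain ⟨φ, hφ, -, hφr⟩ := line_param hL hp
    rw [hνval φ hφ hφr]
    exact ENNReal.mul_lt_top ENNReal.ofReal_lt_top
      ((measure_mono (preimage_sub hφ x s)).trans_lt measure_ball_lt_top)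
  set M := (μ (ball x r)).toReal with hM
  have hMpos : 0 < M := ENNReal.toReal_pos hpos.ne' (hμB r).ne
  have hMd : M ≤ C₀ * (μ (ball x (r / 4))).toReal := by
    have := ENNReal.toReal_mono (ENNReal.mul_lt_top ENNReal.ofReal_lt_top (hμB (r / 4))).ne hdoub
    rwa [ENNReal.toReal_mul, ENNReal.toReal_ofReal hC.le] at this
  -- first test function
  have hF := (le_distB hd μ ν hr (hμB r) (hνB r) (tent_lip x (r / 2))
    ((tent_supp x (r / 2)).trans (ball_subset_ball (by linarith)))).trans hdist
  have hFμ := le_tent_int μ x (ρ := r / 2) (s := r / 4) (by linarith) (by linarith) (hμB _)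
  have hG := (le_distB hd μ ν hr (hμB r) (hνB r) (tent_lip x r) (tent_supp x r)).trans hdist
  have hGμ := tent_int_le μ x hr.le (hμB r)
  have hkey : (8 * C₀)⁻¹ * r * M ≤ ∫ y, tent x (r / 2) y ∂ν := by
    have h1 := (abs_le.mp hF).2
    have h2 : (8 * C₀)⁻¹ * r * M + (8 * C₀)⁻¹ * r * M
        ≤ (r / 2 - r / 4) * (μ (ball x (r / 4))).toReal := by
      calc (8 * C₀)⁻¹ * r * M + (8 * C₀)⁻¹ * r * M = (4 * C₀)⁻¹ * r * M := by
            field_simp; norm_num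
        _ ≤ (4 * C₀)⁻¹ * r * (C₀ * (μ (ball x (r / 4))).toReal) := by gcongr
        _ = _ := by field_simp; norm_num
    linarith
  have hkpos : 0 < (8 * C₀)⁻¹ * r * M := by positivity
  have hne : (L ∩ ball x (r / 2)).Nonempty := by
    by_contra hemp
    rw [Set.not_nonempty_iff_eq_empty] at hemp
    have hz : ∫ y, tent x (r / 2) y ∂ν = 0 := by
      rw [hνdef, integral_smul_measure, setIntegral_eq_zero_of_forall_eq_zero, smul_zero]
      intro y hy
      by_contra h
      have : y ∈ L ∩ ball x (r / 2) := ⟨hy, tent_supp _ _ h⟩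
      simp [hemp] at this
    linarith
  refine ⟨hne, ?_⟩
  obtain ⟨p, hpL, hpB⟩ := hne
  obtain ⟨φ, hφ, hφ0, hφr⟩ := line_param hL hpL
  rw [mem_ball] at hpB
  have hup : (ν (ball x (r / 2))).toReal ≤ c * (2 * r) := by
    rw [hνval φ hφ hφr, ENNReal.toReal_mul, ENNReal.toReal_ofReal hc]
    gcongr
    refine ENNReal.toReal_le_of_le_ofReal (by linarith) ?_
    rw [← Real.volume_ball 0 r]
    refine measure_mono ((preimage_sub hφ x _).trans (ball_subset_ball ?_))
    rw [hφ0]; linarith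
  have hlow : c * (r / 2) ≤ (ν (ball x (3 * r / 4))).toReal := by
    rw [hνval φ hφ hφr, ENNReal.toReal_mul, ENNReal.toReal_ofReal hc]
    gcongr
    have hfin : volume (φ ⁻¹' ball x (3 * r / 4)) ≠ ∞ :=
      ((measure_mono (preimage_sub hφ x _)).trans_lt measure_ball_lt_top).ne
    rw [← ENNReal.ofReal_le_iff_le_toReal hfin,
      show r / 2 = 2 * (r / 4) by ring, ← Real.volume_ball 0 (r / 4)]
    refine measure_mono fun t ht => ?_
    rw [mem_ball, ← hφ.dist_eq, hφ0] at ht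
    rw [Set.mem_preimage, mem_ball]
    linarith [dist_triangle (φ t) p x]
  constructor
  · have h1 := tent_int_le ν x (ρ := r / 2) (by linarith) (hνB _)
    have h2 : (8 * C₀)⁻¹ * r * M ≤ r / 2 * (c * (2 * r)) :=
      hkey.trans (h1.trans (by gcongr))
    have h3 : (8 * C₀)⁻¹ * M ≤ c * r := by
      have : r * ((8 * C₀)⁻¹ * M) ≤ r * (c * r) := by linarith
      exact le_of_mul_le_mul_left this hr
    rw [div_le_iff₀ hr]
    refine le_trans ?_ h3
    gcongr
    norm_num
  · have h1 := le_tent_int ν x (ρ := r) (s := 3 * r / 4) hr.le (by linarith) (hνB _)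
    have h2 := (abs_le.mp hG).1
    have h3 : (8 * C₀)⁻¹ * r * M ≤ r * M := by
      have : (8 * C₀)⁻¹ ≤ 1 := inv_le_one_of_one_le₀ (by linarith)
      have h := mul_le_mul_of_nonneg_right this (mul_pos hr hMpos).le
      linarith
    have h4 : (r - 3 * r / 4) * (c * (r / 2)) ≤ 2 * (r * M) :=
      (mul_le_mul_of_nonneg_left hlow (by linarith)).trans (by linarith)
    have h5 : c * r ≤ 16 * M := by
      have : r * (c * r) ≤ r * (16 * M) := by linarith
      exact le_of_mul_le_mul_left this hr
    rw [le_div_iff₀ hr]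
    have : M ≤ C₀ * M := le_mul_of_one_le_left hMpos.le hC₀
    linarith
end

section
/- For every dimension d ≥ 1 and all constants C₀, Λ ≥ 1 there is a constant C, depending only on d, C₀ and Λ, with the following property. Let μ be a Radon measure on ℝ^d and let B ⊂ B' be balls with r(B') ≤ Λ·r(B), μ((1/4)B) > 0, μ(B') ≤ C₀·μ((1/4)B) and μ(B') ≤ C₀·μ((1/4)B'). Suppose c_B ≥ 0 and the affine line L_B, with L_B ∩ B̄ ≠ ∅, minimize dist_B(μ, c·H^1|_L) over all c ≥ 0 and affine lines L (so dist_B(μ, c_B·H^1|_{L_B}) = α_μ(B)·r(B)·μ(B)), and analogously c_{B'} ≥ 0 and L_{B'} with L_{B'} ∩ B̄' ≠ ∅ minimize for B'. Then the Hausdorff distance satisfies dist_H(L_B ∩ B̄', L_{B'} ∩ B̄') ≤ C·α_μ(B')·r(B'), and |c_B − c_{B'}| ≤ C·α_μ(B')·μ(B')/r(B'). -/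
open MeasureTheory Metric
open scoped ENNReal NNReal

/-- The coefficient `α_μ(B)` for the ball `B` of radius `r`. -/
noncomputable def alphaMu {d : ℕ} (μ : Measure (EuclideanSpace ℝ (Fin d)))
    (B : Set (EuclideanSpace ℝ (Fin d))) (r : ℝ) : ℝ :=
  (1 / (r * (μ B).toReal)) *
    ⨅ p : {p : ℝ × Set (EuclideanSpace ℝ (Fin d)) // 0 ≤ p.1 ∧ IsLine p.2},
      distB B μ ((ENNReal.ofReal p.1.1) • (μH[1].restrict p.1.2))


/-- Ambient space. -/
abbrev EE (d : ℕ) := EuclideanSpace ℝ (Fin d)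

/-- The line through `p` with direction `u`. -/
def lineSet {d : ℕ} (p u : EE d) : Set (EE d) := {y | ∃ t : ℝ, y = p + t • u}

/-- Admissible test functions. -/
def Adm {d : ℕ} (x : EE d) (r : ℝ) (f : EE d → ℝ) : Prop :=
  LipschitzWith 1 f ∧ Function.support f ⊆ ball x r

/-- The measure `c H^1|_L`. -/
noncomputable def lm {d : ℕ} (c : ℝ) (L : Set (EE d)) : Measure (EE d) :=
  (ENNReal.ofReal c) • (μH[1].restrict L)

theorem polar {d : ℕ} (hd : 1 ≤ d) (v : EE d) : ∃ e : EE d, ‖e‖ = 1 ∧ v = ‖v‖ • e := by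
  by_cases h : v = 0
  · refine ⟨EuclideanSpace.single ⟨0, hd⟩ 1, by simp, by simp [h]⟩
  · refine ⟨‖v‖⁻¹ • v, ?_, ?_⟩
    · rw [norm_smul, norm_inv, norm_norm, inv_mul_cancel₀ (norm_ne_zero_iff.2 h)]
    · rw [smul_smul, mul_inv_cancel₀ (norm_ne_zero_iff.2 h), one_smul]

theorem ball_incl {d : ℕ} (hd : 1 ≤ d) {x x' : EE d} {r r' : ℝ} (hr : 0 < r)
    (h : ball x r ⊆ ball x' r') : dist x x' + r ≤ r' := by
  obtain ⟨e, he, hv⟩ := polar hd (x - x')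
  by_contra hlt
  push Not at hlt
  have hx : x ∈ ball x' r' := h (mem_ball_self hr)
  rw [mem_ball] at hx
  have h1 : x + (r' - dist x x') • e ∈ ball x r := by
    rw [mem_ball, dist_eq_norm, add_sub_cancel_left, norm_smul, he, mul_one, Real.norm_eq_abs,
      abs_of_pos (by linarith)]
    linarith
  have h2 := h h1
  rw [mem_ball, dist_eq_norm] at h2
  have : x + (r' - dist x x') • e - x' = r' • e := by
    have : x + (r' - dist x x') • e - x' = (x - x') + (r' - dist x x') • e := by abel
    rw [this, dist_eq_norm, sub_smul]
    nth_rewrite 1 [hv]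
    abel
  rw [this, norm_smul, he, mul_one, Real.norm_eq_abs] at h2
  linarith [le_abs_self r']

theorem adm_bound {d : ℕ} (hd : 1 ≤ d) {x : EE d} {r : ℝ} {f : EE d → ℝ} (hf : Adm x r f)
    (y : EE d) : |f y| ≤ max (r - dist y x) 0 := by
  by_cases hy : y ∈ ball x r
  · obtain ⟨e, he, hv⟩ := polar hd (y - x)
    have hr : 0 < r := by
      rw [mem_ball] at hy; linarith [dist_nonneg (x := y) (y := x)]
    have hz : f (x + r • e) = 0 := by
      by_contra h
      have := hf.2 h
      rw [mem_ball, dist_eq_norm, add_sub_cancel_left, norm_smul, he, mul_one, Real.norm_eq_abs,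
        abs_of_pos hr] at this
      linarith
    have h1 := hf.1.dist_le_mul y (x + r • e)
    have h2 : dist y (x + r • e) = r - dist y x := by
      have : y - (x + r • e) = (‖y - x‖ - r) • e := by
        rw [sub_smul, ← hv]; abel
      rw [dist_eq_norm, this, norm_smul, he, mul_one, Real.norm_eq_abs, dist_eq_norm, abs_sub_comm,
        abs_of_nonneg]
      rw [mem_ball, dist_eq_norm] at hy
      linarith
    rw [hz, h2, Real.dist_eq, sub_zero] at h1
    simp only [NNReal.coe_one, one_mul] at h1
    exact h1.trans (le_max_left _ _)
  · have : f y = 0 := by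
      by_contra h
      exact hy (hf.2 h)
    rw [this, abs_zero]
    exact le_max_right _ _

theorem adm_zero {d : ℕ} {x : EE d} {r : ℝ} {f : EE d → ℝ} (hf : Adm x r f)
    {y : EE d} (hy : r ≤ dist y x) : f y = 0 := by
  by_contra h
  have := hf.2 h
  rw [mem_ball] at this
  linarith

theorem adm_neg {d : ℕ} {x : EE d} {r : ℝ} {f : EE d → ℝ} (hf : Adm x r f) :
    Adm x r (fun y => - f y) := by
  refine ⟨hf.1.neg, ?_⟩
  intro y hy
  apply hf.2
  simpa using hy

theorem adm_mono {d : ℕ} {x x' : EE d} {r r' : ℝ} {f : EE d → ℝ} (hf : Adm x r f)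
    (h : ball x r ⊆ ball x' r') : Adm x' r' f := ⟨hf.1, hf.2.trans h⟩

/-- The cone function. -/
noncomputable def cone {d : ℕ} (x : EE d) (r : ℝ) (y : EE d) : ℝ := max (r - dist y x) 0

theorem cone_adm {d : ℕ} (x : EE d) (r : ℝ) : Adm x r (cone x r) := by
  constructor
  · have h1 : LipschitzWith 1 (fun y : EE d => r - dist y x) := by
      refine LipschitzWith.of_le_add fun a b => ?_
      have := dist_triangle b a x
      rw [dist_comm b a] at this
      linarith
    exact h1.max_const 0
  · intro y hy
    rw [mem_ball]
    by_contra h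
    push Not at h
    apply hy
    unfold cone
    exact max_eq_right (by linarith)

theorem cone_nonneg {d : ℕ} (x : EE d) (r : ℝ) (y : EE d) : 0 ≤ cone x r y := le_max_right _ _

theorem cone_le {d : ℕ} (x : EE d) {r : ℝ} (hr : 0 ≤ r) (y : EE d) : cone x r y ≤ r :=
  max_le (by linarith [dist_nonneg (x := y) (y := x)]) hr

theorem line_isometry {d : ℕ} (p u : EE d) (hu : ‖u‖ = 1) :
    Isometry (fun t : ℝ => p + t • u) := by
  apply Isometry.of_dist_eq
  intro s t
  rw [dist_add_left, dist_eq_norm, ← sub_smul, norm_smul, hu, mul_one, Real.dist_eq,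
    Real.norm_eq_abs]

theorem lineInt {d : ℕ} (p u : EE d) (hu : ‖u‖ = 1) {c : ℝ} (hc : 0 ≤ c) {f : EE d → ℝ}
    (hf : Continuous f) :
    ∫ y, f y ∂(lm c (lineSet p u)) = c * ∫ t : ℝ, f (p + t • u) := by
  have hi := line_isometry p u hu
  have hL : lineSet p u = Set.range (fun t : ℝ => p + t • u) := by
    ext y; simp [lineSet, eq_comm]
  unfold lm
  rw [integral_smul_measure, ENNReal.toReal_ofReal hc, smul_eq_mul, hL,
    ← hi.map_hausdorffMeasure (Or.inl zero_le_one), hausdorffMeasure_real,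
    integral_map hi.continuous.aemeasurable hf.aestronglyMeasurable]

theorem line_dir {d : ℕ} {L : Set (EE d)} (hL : IsLine L) :
    ∃ p u : EE d, ‖u‖ = 1 ∧ L = lineSet p u := by
  obtain ⟨p, v, hv, rfl⟩ := hL
  refine ⟨p, ‖v‖⁻¹ • v, ?_, ?_⟩
  · rw [norm_smul, norm_inv, norm_norm, inv_mul_cancel₀ (norm_ne_zero_iff.2 hv)]
  · ext y
    constructor
    · rintro ⟨t, rfl⟩
      refine ⟨t * ‖v‖, ?_⟩
      rw [smul_smul, mul_assoc, mul_inv_cancel₀ (norm_ne_zero_iff.2 hv), mul_one]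
    · rintro ⟨t, rfl⟩
      exact ⟨t * ‖v‖⁻¹, by rw [smul_smul]⟩

theorem line_isLine {d : ℕ} (p u : EE d) (hu : ‖u‖ = 1) : IsLine (lineSet p u) :=
  ⟨p, u, by rintro rfl; simp at hu, rfl⟩

theorem line_base {d : ℕ} {p q u : EE d} (h : q ∈ lineSet p u) : lineSet p u = lineSet q u := by
  obtain ⟨s, rfl⟩ := h
  ext y
  constructor
  · rintro ⟨t, rfl⟩
    exact ⟨t - s, by rw [sub_smul]; abel⟩
  · rintro ⟨t, rfl⟩
    exact ⟨s + t, by rw [add_smul]; abel⟩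

theorem line_neg {d : ℕ} (p u : EE d) : lineSet p u = lineSet p (-u) := by
  ext y
  constructor
  · rintro ⟨t, rfl⟩
    exact ⟨-t, by simp⟩
  · rintro ⟨t, rfl⟩
    exact ⟨-t, by simp⟩

/-- lower bound for integrals on the real line. -/
theorem int_lower {F : ℝ → ℝ} (hF : Integrable F) (h0 : ∀ t, 0 ≤ F t) {a b k : ℝ} (hab : a ≤ b)
    (hk : ∀ t ∈ Set.Icc a b, k ≤ F t) : (b - a) * k ≤ ∫ t, F t := by
  have h1 : ∫ t in Set.Icc a b, k ≤ ∫ t in Set.Icc a b, F t :=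
    setIntegral_mono_on (by simp) hF.integrableOn measurableSet_Icc hk
  have h2 : ∫ t in Set.Icc a b, F t ≤ ∫ t, F t :=
    setIntegral_le_integral hF (Filter.Eventually.of_forall h0)
  rw [setIntegral_const, smul_eq_mul, Measure.real, Real.volume_Icc, ENNReal.toReal_ofReal (by linarith)] at h1
  linarith

/-- upper bound for integrals on the real line. -/
theorem int_upper {F : ℝ → ℝ} {a b k : ℝ} (hab : a ≤ b)
    (h0 : ∀ t, t ∉ Set.Icc a b → F t = 0)
    (hk : ∀ t ∈ Set.Icc a b, |F t| ≤ k) : |∫ t, F t| ≤ k * (b - a) := by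
  rw [← setIntegral_eq_integral_of_forall_compl_eq_zero h0]
  have := norm_setIntegral_le_of_norm_le_const (μ := volume) (s := Set.Icc a b) (f := F) (C := k)
    (by simp) hk
  rwa [Measure.real, Real.volume_Icc, ENNReal.toReal_ofReal (by linarith)] at this

theorem line_far {d : ℕ} {p u x : EE d} {r R t : ℝ} (hu : ‖u‖ = 1) (hR : dist p x + r ≤ R)
    (ht : t ∉ Set.Icc (-R) R) : r ≤ dist (p + t • u) x := by
  have h1 : R < |t| := by
    by_contra h
    push Not at h
    exact ht (abs_le.1 h)
  have h2 : |t| = dist (p + t • u) p := by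
    rw [dist_eq_norm, add_sub_cancel_left, norm_smul, hu, mul_one, Real.norm_eq_abs]
  have h3 := dist_triangle (p + t • u) x p
  rw [dist_comm x p] at h3
  linarith

theorem line_near {d : ℕ} {p u x : EE d} {t : ℝ} (hu : ‖u‖ = 1) :
    dist (p + t • u) x ≤ dist p x + |t| := by
  have h2 : |t| = dist (p + t • u) p := by
    rw [dist_eq_norm, add_sub_cancel_left, norm_smul, hu, mul_one, Real.norm_eq_abs]
  have h3 := dist_triangle (p + t • u) p x
  linarith

theorem adm_line_integrable {d : ℕ} {x : EE d} {r : ℝ} {f : EE d → ℝ} (hf : Adm x r f)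
    (p u : EE d) (hu : ‖u‖ = 1) : Integrable (fun t : ℝ => f (p + t • u)) := by
  have hc : Continuous (fun t : ℝ => f (p + t • u)) :=
    hf.1.continuous.comp (line_isometry p u hu).continuous
  apply hc.integrable_of_hasCompactSupport
  refine HasCompactSupport.intro (isCompact_Icc (a := -(dist p x + r)) (b := dist p x + r)) ?_
  intro t ht
  exact adm_zero hf (line_far hu le_rfl ht)

theorem adm_integrable {d : ℕ} {x : EE d} {r : ℝ} {f : EE d → ℝ} (hf : Adm x r f)
    (μ : Measure (EE d)) [IsLocallyFiniteMeasure μ] : Integrable f μ := by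
  apply hf.1.continuous.integrable_of_hasCompactSupport
  refine HasCompactSupport.intro (isCompact_closedBall x r) ?_
  intro t ht
  rw [mem_closedBall] at ht
  exact adm_zero hf (by linarith)

/-- The test functionals are bounded by `distB`. -/
theorem le_distB_s13 {d : ℕ} (hd : 1 ≤ d) (μ : Measure (EE d)) [IsLocallyFiniteMeasure μ]
    {x : EE d} {r c : ℝ} (hr : 0 < r) (hc : 0 ≤ c) {L : Set (EE d)} (hL : IsLine L) {f : EE d → ℝ}
    (hf : Adm x r f) :
    |(∫ y, f y ∂μ) - ∫ y, f y ∂(lm c L)| ≤ distB (ball x r) μ (lm c L) := by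
  obtain ⟨p, u, hu, rfl⟩ := line_dir hL
  have hb : BddAbove (Set.range fun f : {f : EE d → ℝ // LipschitzWith 1 f ∧
      Function.support f ⊆ ball x r} => |(∫ y, f.1 y ∂μ) - ∫ y, f.1 y ∂(lm c (lineSet p u))|) := by
    refine ⟨(∫ y, cone x r y ∂μ) + c * (r * ((dist p x + r) - (-(dist p x + r)))), ?_⟩
    rintro _ ⟨⟨f, hf⟩, rfl⟩
    have hf : Adm x r f := hf
    simp only
    have h1 : |∫ y, f y ∂μ| ≤ ∫ y, cone x r y ∂μ :=
      (abs_integral_le_integral_abs).trans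
        (integral_mono (adm_integrable hf μ).abs (adm_integrable (cone_adm x r) μ)
          (adm_bound hd hf))
    have h2 : |∫ t : ℝ, f (p + t • u)| ≤ r * ((dist p x + r) - (-(dist p x + r))) := by
      apply int_upper
      · linarith [dist_nonneg (x := p) (y := x)]
      · intro t ht
        exact adm_zero hf (line_far hu le_rfl ht)
      · intro t _
        exact (adm_bound hd hf _).trans (cone_le x hr.le _)
    rw [lineInt p u hu hc hf.1.continuous]
    refine (abs_sub _ _).trans ?_
    rw [abs_mul, abs_of_nonneg hc]
    gcongr
  exact le_ciSup hb ⟨f, hf⟩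

theorem distB_le {d : ℕ} (μ ν : Measure (EE d)) {x : EE d} {r A : ℝ}
    (h : ∀ f, Adm x r f → |(∫ y, f y ∂μ) - ∫ y, f y ∂ν| ≤ A) : distB (ball x r) μ ν ≤ A := by
  have : Nonempty {f : EE d → ℝ // LipschitzWith 1 f ∧ Function.support f ⊆ ball x r} :=
    ⟨⟨cone x r, cone_adm x r⟩⟩
  exact ciSup_le fun f => h f.1 f.2

theorem distB_nonneg {d : ℕ} (B : Set (EE d)) (μ ν : Measure (EE d)) : 0 ≤ distB B μ ν :=
  Real.iSup_nonneg fun _ => abs_nonneg _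

theorem alpha_nonneg {d : ℕ} (μ : Measure (EE d)) (B : Set (EE d)) {r : ℝ} (hr : 0 < r) :
    0 ≤ alphaMu μ B r := by
  unfold alphaMu
  apply mul_nonneg
  · positivity
  · exact Real.iInf_nonneg fun _ => distB_nonneg _ _ _

theorem alpha_le {d : ℕ} (μ : Measure (EE d)) {x : EE d} {r : ℝ} (hr : 0 < r)
    (hM : 0 < (μ (ball x r)).toReal) {c : ℝ} (hc : 0 ≤ c) {L : Set (EE d)} (hL : IsLine L) :
    alphaMu μ (ball x r) r * r * (μ (ball x r)).toReal ≤ distB (ball x r) μ (lm c L) := by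
  have h : alphaMu μ (ball x r) r * r * (μ (ball x r)).toReal =
      ⨅ p : {p : ℝ × Set (EuclideanSpace ℝ (Fin d)) // 0 ≤ p.1 ∧ IsLine p.2},
      distB (ball x r) μ ((ENNReal.ofReal p.1.1) • (μH[1].restrict p.1.2)) := by
    unfold alphaMu
    field_simp
  rw [h]
  refine ciInf_le ⟨0, ?_⟩ (⟨(c, L), hc, hL⟩ : {p : ℝ × Set (EE d) // 0 ≤ p.1 ∧ IsLine p.2})
  rintro _ ⟨p, rfl⟩
  exact distB_nonneg _ _ _

theorem meas_lower {d : ℕ} {μ : Measure (EE d)} {F : EE d → ℝ} (hF : Integrable F μ)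
    (h0 : ∀ t, 0 ≤ F t) {k : ℝ} {S : Set (EE d)} (hS : MeasurableSet S) (hS' : μ S ≠ ⊤)
    (hk : ∀ t ∈ S, k ≤ F t) : (μ S).toReal * k ≤ ∫ t, F t ∂μ := by
  have h1 : ∫ t in S, k ∂μ ≤ ∫ t in S, F t ∂μ :=
    setIntegral_mono_on (integrableOn_const hS') hF.integrableOn hS hk
  have h2 : ∫ t in S, F t ∂μ ≤ ∫ t, F t ∂μ :=
    setIntegral_le_integral hF (Filter.Eventually.of_forall h0)
  rw [setIntegral_const, smul_eq_mul, Measure.real] at h1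
  linarith

theorem pigeon (d : ℕ) {ρ : ℝ} (hρ : 0 < ρ) : ∃ N : ℕ, 0 < N ∧
    ∀ (μ : Measure (EE d)) [IsLocallyFiniteMeasure μ] (x : EE d) (r : ℝ), 0 < r →
    ∃ z, dist z x ≤ r / 4 ∧ (μ (ball x (r / 4))).toReal ≤ N * (μ (ball z (ρ * r))).toReal := by
  obtain ⟨t, hts, htf, hcov⟩ := (isCompact_closedBall (0 : EE d) (1 / 4)).finite_cover_balls hρ
  lift t to Finset (EE d) using htf
  have hne : t.Nonempty := by
    have h0 : (0 : EE d) ∈ closedBall (0 : EE d) (1 / 4) := by simp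
    have := hcov h0
    simp only [Set.mem_iUnion] at this
    obtain ⟨w, hw, _⟩ := this
    exact ⟨w, hw⟩
  refine ⟨t.card, hne.card_pos, ?_⟩
  intro μ _ x r hr
  have hsub : ball x (r / 4) ⊆ ⋃ w ∈ t, ball (x + r • w) (ρ * r) := by
    intro y hy
    rw [mem_ball, dist_eq_norm] at hy
    have h1 : r⁻¹ • (y - x) ∈ closedBall (0 : EE d) (1 / 4) := by
      rw [mem_closedBall, dist_zero_right, norm_smul, norm_inv, Real.norm_eq_abs, abs_of_pos hr]
      rw [inv_mul_le_iff₀ hr]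
      linarith
    have := hcov h1
    simp only [Set.mem_iUnion] at this ⊢
    obtain ⟨w, hw, hb⟩ := this
    refine ⟨w, hw, ?_⟩
    rw [mem_ball, dist_eq_norm] at hb ⊢
    have : y - (x + r • w) = r • (r⁻¹ • (y - x) - w) := by
      rw [smul_sub, smul_smul, mul_inv_cancel₀ hr.ne', one_smul]
      abel
    rw [this, norm_smul, Real.norm_eq_abs, abs_of_pos hr, mul_comm]
    gcongr
  by_contra hcon
  push Not at hcon
  have h1 : μ.real (ball x (r / 4)) ≤ ∑ w ∈ t, μ.real (ball (x + r • w) (ρ * r)) := by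
    refine (measureReal_mono hsub ?_).trans (measureReal_biUnion_finset_le _ _)
    exact ((measure_biUnion_lt_top t.finite_toSet fun w _ => measure_ball_lt_top)).ne
  have hcard : (0 : ℝ) < t.card := by exact_mod_cast hne.card_pos
  have h2 : ∑ w ∈ t, μ.real (ball (x + r • w) (ρ * r)) <
      ∑ w ∈ t, μ.real (ball x (r / 4)) / t.card := by
    apply Finset.sum_lt_sum_of_nonempty hne
    intro w hw
    rw [lt_div_iff₀ hcard, mul_comm]
    apply hcon
    have := hts hw
    rw [mem_closedBall, dist_zero_right] at this
    rw [dist_eq_norm, add_sub_cancel_left, norm_smul, Real.norm_eq_abs, abs_of_pos hr]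
    nlinarith
  rw [Finset.sum_const, nsmul_eq_mul, mul_div_cancel₀ _ hcard.ne'] at h2
  linarith

theorem line_gain {d : ℕ} {x : EE d} {r : ℝ} (hr : 0 < r) {f : EE d → ℝ}
    (hf : Adm x r f) {e : EE d} (he : ‖e‖ = 1) {s : ℝ} (hs0 : 0 ≤ s) (hs : s ≤ r / 4)
    (hz : r - s - r / 32 ≤ f (x + s • e)) : r ^ 2 / 8 ≤ ∫ t : ℝ, f (x + t • e) := by
  have hz0 : ∀ t, t ∉ Set.Ioc (-r) r → f (x + t • e) = 0 := by
    intro t ht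
    apply adm_zero hf
    rw [dist_eq_norm, add_sub_cancel_left, norm_smul, he, mul_one, Real.norm_eq_abs]
    by_contra h
    push Not at h
    rw [abs_lt] at h
    exact ht ⟨h.1, h.2.le⟩
  rw [← setIntegral_eq_integral_of_forall_compl_eq_zero hz0,
    ← intervalIntegral.integral_of_le (by linarith)]
  set A : ℝ := r - s - r / 32 - r / 4 with hA
  have hcont : Continuous (fun t : ℝ => f (x + t • e)) :=
    hf.1.continuous.comp (line_isometry x e he).continuous
  have h1 : ∫ t in (-r)..r, (A - (t - s) ^ 2 / r) ≤ ∫ t in (-r)..r, f (x + t • e) := by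
    apply intervalIntegral.integral_mono_on (by linarith)
    · apply Continuous.intervalIntegrable
      fun_prop
    · exact hcont.intervalIntegrable _ _
    · intro t _
      have h2 := hf.1.dist_le_mul (x + s • e) (x + t • e)
      rw [(line_isometry x e he).dist_eq, Real.dist_eq, Real.dist_eq] at h2
      simp only [NNReal.coe_one, one_mul] at h2
      have h3 := le_abs_self (f (x + s • e) - f (x + t • e))
      have h4 : |s - t| ≤ (t - s) ^ 2 / r + r / 4 := by
        have h5 : (t - s) ^ 2 / r + r / 4 - |s - t| = (|s - t| - r / 2) ^ 2 / r := by
          have h6 : (t - s) ^ 2 = |s - t| ^ 2 := by rw [sq_abs]; ring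
          rw [h6]
          field_simp
          ring
        have : 0 ≤ (|s - t| - r / 2) ^ 2 / r := by positivity
        linarith
      linarith
  have h2 : ∫ t in (-r)..r, (A - (t - s) ^ 2 / r) =
      (A * r - (r - s) ^ 3 / (3 * r)) - (A * (-r) - (-r - s) ^ 3 / (3 * r)) := by
    apply intervalIntegral.integral_eq_sub_of_hasDerivAt
      (f := fun t : ℝ => A * t - (t - s) ^ 3 / (3 * r))
    · intro t _
      have h3 : HasDerivAt (fun t : ℝ => (t - s) ^ 3) (3 * (t - s) ^ 2) t := by
        have := ((hasDerivAt_id t).sub_const s).fun_pow 3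
        simpa using this
      have h4 := ((hasDerivAt_id t).const_mul A).sub (h3.div_const (3 * r))
      convert! h4 using 1
      field_simp
    · apply Continuous.intervalIntegrable
      fun_prop
  have h3 : (A * r - (r - s) ^ 3 / (3 * r)) - (A * (-r) - (-r - s) ^ 3 / (3 * r)) =
      2 * r * A - 2 * r ^ 2 / 3 - 2 * s ^ 2 := by
    field_simp
    ring
  rw [h2, h3] at h1
  refine le_trans ?_ h1
  rw [hA]
  nlinarith

theorem improve {d : ℕ} (hd : 1 ≤ d) {C₀ : ℝ} (hC₀ : 1 ≤ C₀) : ∃ η : ℝ, 0 < η ∧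
    ∀ (μ : Measure (EE d)) [IsLocallyFiniteMeasure μ] (x : EE d) (r : ℝ), 0 < r →
    (μ (ball x r)).toReal ≤ C₀ * (μ (ball x (r / 4))).toReal →
    ∃ (c : ℝ) (L : Set (EE d)), 0 ≤ c ∧ IsLine L ∧
      distB (ball x r) μ (lm c L) ≤ (∫ y, cone x r y ∂μ) - η * (μ (ball x r)).toReal * r := by
  obtain ⟨N, hN, hp⟩ := pigeon d (ρ := 1 / 128) (by norm_num)
  have hN' : (0 : ℝ) < N := by exact_mod_cast hN
  refine ⟨1 / (2048 * C₀ * N), by positivity, ?_⟩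
  intro μ _ x r hr hM
  obtain ⟨z, hzx, hz⟩ := hp μ x r hr
  obtain ⟨e, he, hv⟩ := polar hd (z - x)
  set M := (μ (ball x r)).toReal with hMdef
  set m := (μ (ball z (1 / 128 * r))).toReal with hmdef
  have hm0 : 0 ≤ m := ENNReal.toReal_nonneg
  have hMm : M ≤ C₀ * N * m := by
    calc M ≤ C₀ * (μ (ball x (r / 4))).toReal := hM
      _ ≤ C₀ * (N * m) := by gcongr
      _ = _ := by ring
  have hgoal : 1 / (2048 * C₀ * N) * M * r ≤ m * r / 2048 := by
    rw [div_mul_eq_mul_div, div_mul_eq_mul_div, div_le_div_iff₀ (by positivity) (by norm_num)]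
    nlinarith
  set s := dist z x with hs
  have hzs : z = x + s • e := by
    rw [hs, dist_eq_norm, ← hv]; abel
  refine ⟨m / (256 * r), lineSet x e, by positivity, line_isLine x e he, ?_⟩
  apply distB_le
  have key : ∀ f, Adm x r f → (∫ y, f y ∂μ) - ∫ y, f y ∂(lm (m / (256 * r)) (lineSet x e)) ≤
      (∫ y, cone x r y ∂μ) - m * r / 2048 := by
    intro f hf
    rw [lineInt x e he (by positivity) hf.1.continuous]
    have hci := adm_integrable (cone_adm x r) μ
    have hfi := adm_integrable hf μ
    have hle : ∀ y, f y ≤ cone x r y := fun y => (le_abs_self _).trans (adm_bound hd hf y)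
    by_cases hc : r - s - r / 32 ≤ f z
    · rw [hzs] at hc
      have h1 := line_gain hr hf he dist_nonneg hzx hc
      have h2 : ∫ y, f y ∂μ ≤ ∫ y, cone x r y ∂μ := integral_mono hfi hci hle
      have h3 : m / (256 * r) * (r ^ 2 / 8) ≤ m / (256 * r) * ∫ t : ℝ, f (x + t • e) := by
        gcongr
      have h4 : m / (256 * r) * (r ^ 2 / 8) = m * r / 2048 := by
        field_simp
        ring
      linarith
    · push Not at hc
      have h1 : m * (r / 64) ≤ ∫ y, (cone x r y - f y) ∂μ := by
        apply meas_lower (hci.sub hfi) (fun y => sub_nonneg.2 (hle y)) measurableSet_ball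
          measure_ball_lt_top.ne
        intro y hy
        rw [mem_ball] at hy
        have h2 := hf.1.dist_le_mul y z
        have h3 := (cone_adm x r).1.dist_le_mul z y
        rw [dist_comm z y] at h3
        rw [Real.dist_eq] at h2 h3
        simp only [NNReal.coe_one, one_mul] at h2 h3
        have h4 := (le_abs_self _).trans h2
        have h5 := (le_abs_self _).trans h3
        have h6 : r - s ≤ cone x r z := le_max_left _ _
        simp only [Pi.sub_apply]
        linarith
      rw [integral_sub hci hfi] at h1
      have h2 : |∫ t : ℝ, f (x + t • e)| ≤ r * (r - (-r)) := by
        apply int_upper (by linarith)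
        · intro t ht
          exact adm_zero hf (line_far he (by simp) ht)
        · intro t _
          exact (adm_bound hd hf _).trans (cone_le x hr.le _)
      have h3 : m / (256 * r) * (-∫ t : ℝ, f (x + t • e)) ≤ m / (256 * r) * (r * (r - (-r))) := by
        gcongr
        exact (neg_le_abs _).trans h2
      have h4 : m / (256 * r) * (r * (r - (-r))) = m * r / 128 := by
        field_simp
        ring
      have h5 : 0 ≤ m * r := by positivity
      linarith
  intro f hf
  rw [abs_le']
  constructor
  · linarith [key f hf]
  · have := key _ (adm_neg hf)
    rw [integral_neg, integral_neg] at this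
    linarith

/-- Upper bound on the density of a minimizer. -/
theorem dens_upper {d : ℕ} (hd : 1 ≤ d) {C₀ : ℝ} (hC₀ : 1 ≤ C₀) : ∃ K : ℝ, 0 < K ∧
    ∀ (μ : Measure (EE d)) [IsLocallyFiniteMeasure μ] (x : EE d) (r : ℝ), 0 < r →
    0 < (μ (ball x r)).toReal →
    (μ (ball x r)).toReal ≤ C₀ * (μ (ball x (r / 4))).toReal →
    ∀ (c : ℝ) (L : Set (EE d)), 0 ≤ c → IsLine L →
    (∀ c' L', 0 ≤ c' → IsLine L' →
      distB (ball x r) μ (lm c L) ≤ distB (ball x r) μ (lm c' L')) →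
    c ≤ K * (μ (ball x r)).toReal / r := by
  obtain ⟨η, hη, himp⟩ := improve hd hC₀
  refine ⟨16 / η ^ 2, by positivity, ?_⟩
  intro μ _ x r hr hM0 hM c L hc hL hmin
  obtain ⟨c', L', hc', hL', hle⟩ := himp μ x r hr hM
  have hV := (hmin c' L' hc' hL').trans hle
  set M := (μ (ball x r)).toReal with hMdef
  have hci := adm_integrable (cone_adm x r) μ
  obtain ⟨p₀, u, hu, hLeq⟩ := line_dir hL
  have hIle : ∫ y, cone x r y ∂μ ≤ M * r := by
    have h0 : ∀ y, y ∉ ball x r → cone x r y = 0 := fun y hy =>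
      adm_zero (cone_adm x r) (by rw [mem_ball] at hy; linarith)
    rw [← setIntegral_eq_integral_of_forall_compl_eq_zero h0]
    calc ∫ y in ball x r, cone x r y ∂μ ≤ ∫ y in ball x r, r ∂μ :=
          setIntegral_mono_on hci.integrableOn (integrableOn_const measure_ball_lt_top.ne)
            measurableSet_ball fun y _ => cone_le x hr.le y
      _ = M * r := by rw [setIntegral_const, smul_eq_mul]; rfl
  -- the line meets a smaller ball
  have hmeet : ∃ p ∈ L, dist p x < (1 - η / 2) * r := by
    by_contra hcon
    push Not at hcon
    have hsm := cone_adm x ((1 - η / 2) * r)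
    have hsm' : Adm x r (cone x ((1 - η / 2) * r)) := adm_mono hsm (ball_subset_ball (by nlinarith))
    have h1 := le_distB_s13 hd μ hr hc hL hsm'
    have h2 : ∫ y, cone x ((1 - η / 2) * r) y ∂(lm c L) = 0 := by
      rw [hLeq, lineInt p₀ u hu hc hsm.1.continuous]
      have : ∀ t : ℝ, cone x ((1 - η / 2) * r) (p₀ + t • u) = 0 := by
        intro t
        apply adm_zero hsm
        apply hcon
        rw [hLeq]
        exact ⟨t, rfl⟩
      simp [this]
    rw [h2, sub_zero] at h1
    have h3 := (le_abs_self _).trans h1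
    have hsi := adm_integrable hsm' μ
    have h4 : ∫ y, (cone x r y - cone x ((1 - η / 2) * r) y) ∂μ ≤ M * (η / 2 * r) := by
      have h0 : ∀ y, y ∉ ball x r → cone x r y - cone x ((1 - η / 2) * r) y = 0 := fun y hy => by
        rw [mem_ball] at hy
        rw [adm_zero (cone_adm x r) (by linarith), adm_zero hsm' (by linarith), sub_zero]
      rw [← setIntegral_eq_integral_of_forall_compl_eq_zero h0]
      calc ∫ y in ball x r, (cone x r y - cone x ((1 - η / 2) * r) y) ∂μ
          ≤ ∫ y in ball x r, (η / 2 * r) ∂μ :=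
            setIntegral_mono_on (hci.sub hsi).integrableOn (integrableOn_const measure_ball_lt_top.ne)
              measurableSet_ball fun y _ => by
                have : 0 ≤ η / 2 * r := by positivity
                unfold cone
                rw [sub_le_iff_le_add]
                apply max_le
                · have := le_max_left ((1 - η / 2) * r - dist y x) 0
                  linarith
                · have := le_max_right ((1 - η / 2) * r - dist y x) 0
                  linarith
        _ = M * (η / 2 * r) := by rw [setIntegral_const, smul_eq_mul]; rfl
    rw [integral_sub hci hsi] at h4
    have h5 : 0 < η * M * r := by positivity
    linarith
  obtain ⟨p, hpL, hpx⟩ := hmeet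
  rw [hLeq] at hpL
  have hLp := hLeq.trans (line_base hpL)
  have h1 := le_distB_s13 hd μ hr hc hL (cone_adm x r)
  have h2 : (η * r / 4 - -(η * r / 4)) * (η * r / 4) ≤ ∫ t : ℝ, cone x r (p + t • u) := by
    apply int_lower (adm_line_integrable (cone_adm x r) p u hu) (fun t => cone_nonneg _ _ _)
    · have : 0 < η * r := by positivity
      linarith
    · intro t ht
      have h3 := line_near (p := p) (x := x) (t := t) hu
      have h4 : |t| ≤ η * r / 4 := abs_le.2 ht
      refine le_trans ?_ (le_max_left _ _)
      linarith
  rw [hLp, lineInt p u hu hc (cone_adm x r).1.continuous, ← hLp] at h1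
  have h3 := (neg_le_abs _).trans h1
  have h4 : c * ((η * r / 4 - -(η * r / 4)) * (η * r / 4)) ≤ c * ∫ t : ℝ, cone x r (p + t • u) := by
    gcongr
  have h5 : 0 < η * M * r := by positivity
  rw [div_mul_eq_mul_div, div_div, le_div_iff₀ (by positivity)]
  have h6 : c * (η ^ 2 * r ^ 2) ≤ 16 * M * r := by nlinarith
  have h7 : (c * (η ^ 2 * r)) * r ≤ (16 * M) * r := by linarith
  exact le_of_mul_le_mul_right h7 hr

/-- Projection onto the orthogonal complement of the unit vector `u`. -/
noncomputable def Pj {d : ℕ} (u v : EE d) : EE d := v - (inner ℝ u v : ℝ) • u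

theorem Pj_sq {d : ℕ} {u : EE d} (hu : ‖u‖ = 1) (v : EE d) :
    ‖Pj u v‖ ^ 2 = ‖v‖ ^ 2 - (inner ℝ u v : ℝ) ^ 2 := by
  unfold Pj
  rw [norm_sub_sq_real, inner_smul_right, norm_smul, hu, real_inner_comm u v, Real.norm_eq_abs,
    mul_one, sq_abs]
  ring

theorem Pj_le {d : ℕ} {u : EE d} (hu : ‖u‖ = 1) (v : EE d) : ‖Pj u v‖ ≤ ‖v‖ := by
  have := Pj_sq hu v
  apply le_of_sq_le_sq _ (norm_nonneg v)
  nlinarith [sq_nonneg (inner ℝ u v : ℝ)]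

theorem Pj_add_smul {d : ℕ} (u a b : EE d) (t : ℝ) : Pj u (a + t • b) = Pj u a + t • Pj u b := by
  unfold Pj
  rw [inner_add_right, inner_smul_right, add_smul, smul_sub, smul_smul]
  abel

theorem Pj_self {d : ℕ} {u : EE d} (hu : ‖u‖ = 1) : Pj u u = 0 := by
  unfold Pj
  rw [real_inner_self_eq_norm_sq, hu]
  simp

/-- Test function measuring the distance to a line. -/
noncomputable def tf {d : ℕ} (x : EE d) (r : ℝ) (p u y : EE d) : ℝ :=
  min ‖Pj u (y - p)‖ (cone x r y)

theorem tf_adm {d : ℕ} (x : EE d) {r : ℝ} (p : EE d) {u : EE d} (hu : ‖u‖ = 1) :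
    Adm x r (tf x r p u) := by
  constructor
  · have h1 : LipschitzWith 1 (fun y : EE d => ‖Pj u (y - p)‖) := by
      refine LipschitzWith.of_le_add fun a b => ?_
      have h2 : a - p = (b - p) + (1 : ℝ) • (a - b) := by rw [one_smul]; abel
      rw [h2, Pj_add_smul, one_smul, dist_eq_norm]
      refine (norm_add_le _ _).trans ?_
      linarith [Pj_le hu (a - b)]
    have := h1.min (cone_adm x r).1
    rwa [max_self] at this
  · intro y hy
    rw [mem_ball]
    by_contra h
    push Not at h
    apply hy
    unfold tf
    rw [adm_zero (cone_adm x r) h]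
    exact min_eq_right (norm_nonneg _)

theorem tf_nonneg {d : ℕ} (x : EE d) (r : ℝ) (p u y : EE d) : 0 ≤ tf x r p u y :=
  le_min (norm_nonneg _) (cone_nonneg _ _ _)

theorem tf_line {d : ℕ} (x : EE d) (r : ℝ) (p : EE d) {u : EE d} (hu : ‖u‖ = 1) (t : ℝ) :
    tf x r p u (p + t • u) = 0 := by
  have : Pj u (p + t • u - p) = 0 := by
    have h : p + t • u - p = 0 + t • u := by abel
    rw [h, Pj_add_smul, Pj_self hu]
    simp [Pj]
  unfold tf
  rw [this, norm_zero]
  exact min_eq_left (cone_nonneg _ _ _)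

theorem exists_small {F : ℝ → ℝ} (hc : Continuous F) (hF : Integrable F) (h0 : ∀ t, 0 ≤ F t)
    {r A a b : ℝ} (hr : 0 < r) (hab : b - a = r / 8) (hI : ∫ t, F t ≤ A * r) :
    ∃ t ∈ Set.Icc a b, F t ≤ 8 * A := by
  obtain ⟨t, ht, hmin⟩ := (isCompact_Icc (a := a) (b := b)).exists_isMinOn
    ⟨a, ⟨le_rfl, by linarith⟩⟩ hc.continuousOn
  refine ⟨t, ht, ?_⟩
  have := int_lower hF h0 (by linarith : a ≤ b) (fun s hs => hmin hs)
  rw [hab] at this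
  have h2 : F t * r ≤ 8 * A * r := by linarith
  exact le_of_mul_le_mul_right h2 hr

theorem close {d : ℕ} {x p u p' u' : EE d} {r A : ℝ} (hr : 0 < r) (hu : ‖u‖ = 1) (hu' : ‖u'‖ = 1)
    (hp : dist p x < r / 2) (hA : 8 * A < r / 4)
    (hI : ∫ t : ℝ, tf x r p' u' (p + t • u) ≤ A * r) :
    ‖Pj u' (p - p')‖ ≤ 24 * A ∧ ‖Pj u' u‖ ≤ 64 * A / r := by
  have hadm := tf_adm x (r := r) p' hu'
  have hcont : Continuous (fun t : ℝ => tf x r p' u' (p + t • u)) :=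
    hadm.1.continuous.comp (line_isometry p u hu).continuous
  have hint := adm_line_integrable hadm p u hu
  have key : ∀ t : ℝ, |t| ≤ r / 4 → tf x r p' u' (p + t • u) ≤ 8 * A →
      ‖Pj u' (p - p') + t • Pj u' u‖ ≤ 8 * A := by
    intro t ht h
    have h1 := line_near (p := p) (x := x) (t := t) hu
    have h2 : r / 4 ≤ cone x r (p + t • u) := le_trans (by linarith) (le_max_left _ _)
    unfold tf at h
    rw [min_le_iff] at h
    rcases h with h | h
    · have h3 : p + t • u - p' = (p - p') + t • u := by abel
      rwa [h3, Pj_add_smul] at h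
    · linarith
  obtain ⟨t₁, ht₁, h₁⟩ := exists_small (a := -(r / 4)) (b := -(r / 8)) hcont hint
    (fun t => tf_nonneg _ _ _ _ _) hr (by ring) hI
  obtain ⟨t₂, ht₂, h₂⟩ := exists_small (a := r / 8) (b := r / 4) hcont hint
    (fun t => tf_nonneg _ _ _ _ _) hr (by ring) hI
  have ht₁' : |t₁| ≤ r / 4 := abs_le.2 ⟨ht₁.1, by linarith [ht₁.2]⟩
  have ht₂' : |t₂| ≤ r / 4 := abs_le.2 ⟨by linarith [ht₂.1], ht₂.2⟩
  have k₁ := key t₁ ht₁' h₁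
  have k₂ := key t₂ ht₂' h₂
  set a := Pj u' (p - p')
  set b := Pj u' u
  have hb : ‖b‖ ≤ 64 * A / r := by
    have h3 : (t₂ - t₁) • b = (a + t₂ • b) - (a + t₁ • b) := by rw [sub_smul]; abel
    have h4 : (t₂ - t₁) * ‖b‖ ≤ 16 * A := by
      have : (t₂ - t₁) * ‖b‖ = ‖(t₂ - t₁) • b‖ := by
        rw [norm_smul, Real.norm_eq_abs, abs_of_nonneg (by linarith [ht₁.2, ht₂.1])]
      rw [this, h3]
      exact (norm_sub_le _ _).trans (by linarith)
    rw [le_div_iff₀ hr]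
    nlinarith [norm_nonneg b, ht₁.2, ht₂.1]
  refine ⟨?_, hb⟩
  have h3 : a = (a + t₁ • b) - t₁ • b := by abel
  rw [h3]
  refine (norm_sub_le _ _).trans ?_
  rw [norm_smul, Real.norm_eq_abs]
  have h4 : |t₁| * ‖b‖ ≤ r / 4 * (64 * A / r) := by gcongr
  have h5 : r / 4 * (64 * A / r) = 16 * A := by field_simp; ring
  linarith

theorem one_side {d : ℕ} {x x' p u p' u' : EE d} {r r' A Λ : ℝ} (hr : 0 < r) (hu : ‖u‖ = 1)
    (hΛ : 1 ≤ Λ) (hrr : r' ≤ Λ * r) (hxx : dist x x' + r ≤ r')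
    (hA0 : 0 ≤ A) (hA : 152 * Λ * A ≤ r / 2)
    (hp : dist p x < r / 2) (hp' : dist p' x < r / 2)
    (h1 : ‖Pj u' (p - p')‖ ≤ 24 * A) (h2 : ‖Pj u' u‖ ≤ 64 * A / r)
    (y : EE d) (hy : y ∈ lineSet p u ∩ closedBall x' r') :
    ∃ z ∈ lineSet p' u' ∩ closedBall x' r', dist y z ≤ 1064 * Λ ^ 2 * A := by
  obtain ⟨⟨t, rfl⟩, hyb⟩ := hy
  rw [mem_closedBall] at hyb
  have hpx : dist p x' ≤ r' - r / 2 := by linarith [dist_triangle p x x']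
  have hpx' : dist p' x' ≤ r' - r / 2 := by linarith [dist_triangle p' x x']
  have hr' : r ≤ r' := by linarith [dist_nonneg (x := x) (y := x')]
  have ht : |t| ≤ 2 * r' := by
    have h3 : |t| = dist (p + t • u) p := by
      rw [dist_eq_norm, add_sub_cancel_left, norm_smul, hu, mul_one, Real.norm_eq_abs]
    rw [h3]
    have := dist_triangle_right (p + t • u) p x'
    linarith
  set y := p + t • u with hy
  set η := 152 * Λ * A with hη
  have hη0 : 0 ≤ η := by positivity
  set k : ℝ := inner ℝ u' (y - p') with hk
  set y' := p' + k • u' with hy'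
  have hyy : ‖y - y'‖ ≤ η := by
    have h3 : y - y' = Pj u' (p - p') + t • Pj u' u := by
      rw [← Pj_add_smul]
      have h4 : p - p' + t • u = y - p' := by rw [hy]; abel
      rw [h4, Pj, ← hk, hy']
      abel
    rw [h3]
    refine (norm_add_le _ _).trans ?_
    rw [norm_smul, Real.norm_eq_abs]
    have h4 : |t| * ‖Pj u' u‖ ≤ (2 * (Λ * r)) * (64 * A / r) := by
      gcongr
      linarith
    have h5 : (2 * (Λ * r)) * (64 * A / r) = 128 * Λ * A := by field_simp; ring
    nlinarith
  set s := 2 * η / r with hs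
  have hs0 : 0 ≤ s := by positivity
  have hs1 : s ≤ 1 := by rw [hs, div_le_one hr]; linarith
  have hsr : s * r = 2 * η := by rw [hs]; field_simp
  have hy'x : ‖y' - x'‖ ≤ r' + η := by
    have h3 : y' - x' = (y - x') - (y - y') := by abel
    rw [h3]
    refine (norm_sub_le _ _).trans ?_
    rw [dist_eq_norm] at hyb
    linarith
  rw [dist_eq_norm] at hpx'
  refine ⟨p' + ((1 - s) * k) • u', ⟨⟨_, rfl⟩, ?_⟩, ?_⟩
  · rw [mem_closedBall, dist_eq_norm]
    have h3 : p' + ((1 - s) * k) • u' - x' = (1 - s) • (y' - x') + s • (p' - x') := by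
      rw [hy', mul_smul]
      module
    rw [h3]
    refine (norm_add_le _ _).trans ?_
    rw [norm_smul, norm_smul, Real.norm_eq_abs, Real.norm_eq_abs, abs_of_nonneg hs0,
      abs_of_nonneg (by linarith)]
    have h4 : (1 - s) * ‖y' - x'‖ ≤ (1 - s) * (r' + η) := by
      apply mul_le_mul_of_nonneg_left hy'x; linarith
    have h5 : s * ‖p' - x'‖ ≤ s * (r' - r / 2) := by gcongr
    nlinarith
  · rw [dist_eq_norm]
    have h3 : y - (p' + ((1 - s) * k) • u') = (y - y') + s • (y' - p') := by
      rw [hy', mul_smul]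
      module
    rw [h3]
    refine (norm_add_le _ _).trans ?_
    rw [norm_smul, Real.norm_eq_abs, abs_of_nonneg hs0]
    have h4 : ‖y' - p'‖ ≤ 3 * r' := by
      have h5 : y' - p' = (y' - x') - (p' - x') := by abel
      rw [h5]
      refine (norm_sub_le _ _).trans ?_
      linarith
    have h5 : s * ‖y' - p'‖ ≤ s * (3 * (Λ * r)) := by
      gcongr
      linarith
    have h6 : s * (3 * (Λ * r)) = 6 * Λ * η := by
      calc s * (3 * (Λ * r)) = 3 * Λ * (s * r) := by ring
        _ = _ := by rw [hsr]; ring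
    have h7 : 1064 * Λ ^ 2 * A = 7 * Λ * η := by rw [hη]; ring
    nlinarith

theorem sign_choice {d : ℕ} {u u' : EE d} (hu : ‖u‖ = 1) (hu' : ‖u'‖ = 1) :
    ∃ w, (w = u' ∨ w = -u') ∧ ‖w‖ = 1 ∧ ‖u - w‖ ≤ 2 * ‖Pj u' u‖ := by
  have hP := Pj_sq hu' u
  rw [hu] at hP
  set k : ℝ := inner ℝ u' u with hk
  have hk1 : |k| ≤ 1 := by
    have := abs_real_inner_le_norm u' u
    rwa [hu, hu', mul_one] at this
  rw [abs_le] at hk1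
  rcases le_total 0 k with h | h
  · refine ⟨u', Or.inl rfl, hu', ?_⟩
    apply le_of_sq_le_sq _ (by positivity)
    rw [norm_sub_sq_real, real_inner_comm, ← hk, hu, hu']
    nlinarith
  · refine ⟨-u', Or.inr rfl, by rwa [norm_neg], ?_⟩
    apply le_of_sq_le_sq _ (by positivity)
    rw [norm_sub_sq_real, real_inner_comm, inner_neg_left, ← hk, hu, norm_neg, hu']
    nlinarith

theorem Gdiff {d : ℕ} {x p u q w : EE d} {r A : ℝ} (hr : 0 < r) (hu : ‖u‖ = 1) (hw : ‖w‖ = 1)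
    (hp : dist p x < r / 2) (hA : 24 * A ≤ r / 2) (h1 : ‖p - q‖ ≤ 24 * A)
    (h2 : ‖u - w‖ ≤ 128 * A / r) :
    |(∫ t : ℝ, cone x r (p + t • u)) - ∫ t : ℝ, cone x r (q + t • w)| ≤ 1120 * A * r := by
  have hadm := cone_adm x r
  rw [← integral_sub (adm_line_integrable hadm p u hu) (adm_line_integrable hadm q w hw)]
  have hq : dist q x ≤ r := by
    have := dist_triangle_left q x p
    rw [dist_eq_norm p q] at this
    linarith
  have h3 : 1120 * A * r = 280 * A * (2 * r - (-(2 * r))) := by ring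
  rw [h3]
  apply int_upper (by linarith)
  · intro t ht
    rw [adm_zero hadm (line_far hu (by linarith) ht), adm_zero hadm (line_far hw (by linarith) ht),
      sub_zero]
  · intro t ht
    have h4 := hadm.1.dist_le_mul (p + t • u) (q + t • w)
    rw [Real.dist_eq] at h4
    simp only [NNReal.coe_one, one_mul] at h4
    refine h4.trans ?_
    have h5 : p + t • u - (q + t • w) = (p - q) + t • (u - w) := by module
    rw [dist_eq_norm, h5]
    refine (norm_add_le _ _).trans ?_
    rw [norm_smul, Real.norm_eq_abs]
    have h6 : |t| * ‖u - w‖ ≤ (2 * r) * (128 * A / r) := by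
      gcongr
      exact abs_le.2 ht
    have h7 : (2 * r) * (128 * A / r) = 256 * A := by field_simp; ring
    linarith

theorem dens_lower {d : ℕ} {x : EE d} {r c m : ℝ} {L : Set (EE d)} (hr : 0 < r) (hm : 0 < m)
    (hc : 0 ≤ c) (hL : IsLine L) (h : m * r / 8 ≤ ∫ y, cone x (r / 2) y ∂(lm c L)) :
    ∃ p u : EE d, ‖u‖ = 1 ∧ L = lineSet p u ∧ dist p x < r / 2 ∧ m / (8 * r) ≤ c := by
  obtain ⟨p₀, u, hu, hLeq⟩ := line_dir hL
  have hadm := cone_adm x (r / 2)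
  have hmr : 0 < m * r := by positivity
  have hex : ∃ p ∈ L, dist p x < r / 2 := by
    by_contra hcon
    push Not at hcon
    rw [hLeq, lineInt p₀ u hu hc hadm.1.continuous] at h
    have : ∀ t : ℝ, cone x (r / 2) (p₀ + t • u) = 0 := by
      intro t
      apply adm_zero hadm
      apply hcon
      rw [hLeq]
      exact ⟨t, rfl⟩
    simp only [this, integral_zero, mul_zero] at h
    linarith
  obtain ⟨p, hpL, hp⟩ := hex
  rw [hLeq] at hpL
  have hLp := hLeq.trans (line_base hpL)
  refine ⟨p, u, hu, hLp, hp, ?_⟩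
  rw [hLp, lineInt p u hu hc hadm.1.continuous] at h
  have h1 : |∫ t : ℝ, cone x (r / 2) (p + t • u)| ≤ r / 2 * (r - (-r)) := by
    apply int_upper (by linarith)
    · intro t ht
      exact adm_zero hadm (line_far hu (by linarith) ht)
    · intro t _
      rw [abs_of_nonneg (cone_nonneg _ _ _)]
      exact cone_le x (by linarith) _
  have h2 := (le_abs_self _).trans h1
  have h3 : c * ∫ t : ℝ, cone x (r / 2) (p + t • u) ≤ c * (r / 2 * (r - (-r))) := by gcongr
  rw [div_le_iff₀ (by positivity)]
  have h4 : m * r ≤ (c * (8 * r)) * r := by nlinarith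
  exact le_of_mul_le_mul_right h4 hr

/-- The comparison estimate when `α` is small. -/
theorem small_case {d : ℕ} (hd : 1 ≤ d) {C₀ Λ K α : ℝ} (hC₀ : 1 ≤ C₀) (hΛ : 1 ≤ Λ) (hK : 0 < K)
    (hα0 : 0 ≤ α) (hα : α ≤ 1 / (8000 * Λ ^ 2 * C₀))
    (μ : Measure (EE d)) [IsLocallyFiniteMeasure μ] {x x' : EE d} {r r' M m : ℝ} (hr : 0 < r)
    (hr' : 0 < r') (hxx : dist x x' + r ≤ r') (hrr : r' ≤ Λ * r)
    (hmdef : m = (μ (ball x (r / 4))).toReal) (hm : 0 < m) (hM : M ≤ C₀ * m) (hM0 : 0 < M)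
    {c c' : ℝ} {L L' : Set (EE d)} (hc : 0 ≤ c) (hc' : 0 ≤ c') (hL : IsLine L) (hL' : IsLine L')
    (hν : ∀ f, Adm x r f → |(∫ y, f y ∂μ) - ∫ y, f y ∂(lm c L)| ≤ α * r' * M)
    (hν' : ∀ f, Adm x r f → |(∫ y, f y ∂μ) - ∫ y, f y ∂(lm c' L')| ≤ α * r' * M)
    (hcK : c ≤ K * M / r) :
    hausdorffDist (L ∩ closedBall x' r') (L' ∩ closedBall x' r') ≤
        (17024 * Λ ^ 2 * C₀) * α * r' ∧
      |c - c'| ≤ (Λ ^ 2 * (16 + 143360 * K * C₀)) * α * M / r' := by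
  have hα' : 8000 * Λ ^ 2 * C₀ * α ≤ 1 := by
    rw [le_div_iff₀ (by positivity)] at hα
    linarith
  set A : ℝ := 16 * C₀ * α * r' with hAdef
  have hA0 : 0 ≤ A := by positivity
  have hAr : 500 * Λ * A ≤ r := by
    calc 500 * Λ * A = 8000 * Λ * C₀ * α * r' := by rw [hAdef]; ring
      _ ≤ 8000 * Λ * C₀ * α * (Λ * r) := by gcongr
      _ = (8000 * Λ ^ 2 * C₀ * α) * r := by ring
      _ ≤ 1 * r := by gcongr
      _ = r := one_mul r
  have hΛA : A ≤ Λ * A := by nlinarith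
  set D : ℝ := α * r' * M with hDdef
  have hD0 : 0 ≤ D := by positivity
  have hDA : 16 * D ≤ A * m := by
    calc 16 * D = 16 * α * r' * M := by rw [hDdef]; ring
      _ ≤ 16 * α * r' * (C₀ * m) := by gcongr
      _ = A * m := by rw [hAdef]; ring
  have hDm : D ≤ m * r / 8 := by
    have : A * m ≤ r * m := by
      apply mul_le_mul_of_nonneg_right _ hm.le
      linarith
    nlinarith
  -- lower bounds
  have hg := cone_adm x (r / 2)
  have hg' : Adm x r (cone x (r / 2)) := adm_mono hg (ball_subset_ball (by linarith))
  have hμg : m * (r / 4) ≤ ∫ y, cone x (r / 2) y ∂μ := by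
    rw [hmdef]
    apply meas_lower (adm_integrable hg μ) (fun y => cone_nonneg _ _ _) measurableSet_ball
      measure_ball_lt_top.ne
    intro y hy
    rw [mem_ball] at hy
    exact le_trans (by linarith) (le_max_left _ _)
  obtain ⟨p, u, hu, hLp, hp, hcl⟩ := dens_lower (x := x) hr hm hc hL (by
    have := (le_abs_self _).trans (hν _ hg'); linarith)
  obtain ⟨p', u', hu', hLp', hp', hcl'⟩ := dens_lower (x := x) hr hm hc' hL' (by
    have := (le_abs_self _).trans (hν' _ hg'); linarith)
  rw [hLp] at hν ⊢
  rw [hLp'] at hν' ⊢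
  have hνν : ∀ f, Adm x r f → |c * (∫ t : ℝ, f (p + t • u)) - c' * ∫ t : ℝ, f (p' + t • u')| ≤
      2 * D := by
    intro f hf
    have h1 := hν f hf
    have h2 := hν' f hf
    rw [lineInt p u hu hc hf.1.continuous] at h1
    rw [lineInt p' u' hu' hc' hf.1.continuous] at h2
    rw [abs_le] at h1 h2 ⊢
    constructor <;> linarith [h1.1, h1.2, h2.1, h2.2]
  have aux : ∀ (c₁ I : ℝ), m / (8 * r) ≤ c₁ → 0 ≤ I → c₁ * I ≤ 2 * D → I ≤ A * r := by
    intro c₁ I h1 h2 h3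
    have h4 : m / (8 * r) * I ≤ 2 * D := (mul_le_mul_of_nonneg_right h1 h2).trans h3
    rw [div_mul_eq_mul_div, div_le_iff₀ (by positivity)] at h4
    have h5 : m * I ≤ m * (A * r) := by nlinarith
    exact le_of_mul_le_mul_left h5 hm
  have hI1 : ∫ t : ℝ, tf x r p' u' (p + t • u) ≤ A * r := by
    have h1 := hνν _ (tf_adm x p' hu')
    simp only [tf_line x r p' hu', integral_zero, mul_zero, sub_zero] at h1
    exact aux c _ hcl (integral_nonneg fun t => tf_nonneg _ _ _ _ _) ((le_abs_self _).trans h1)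
  have hI2 : ∫ t : ℝ, tf x r p u (p' + t • u') ≤ A * r := by
    have h1 := hνν _ (tf_adm x p hu)
    simp only [tf_line x r p hu, integral_zero, mul_zero, zero_sub, abs_neg] at h1
    exact aux c' _ hcl' (integral_nonneg fun t => tf_nonneg _ _ _ _ _) ((le_abs_self _).trans h1)
  obtain ⟨e1, e2⟩ := close hr hu hu' hp (by linarith) hI1
  obtain ⟨e3, e4⟩ := close hr hu' hu hp' (by linarith) hI2
  constructor
  · have hb : (17024 * Λ ^ 2 * C₀) * α * r' = 1064 * Λ ^ 2 * A := by rw [hAdef]; ring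
    rw [hb]
    apply hausdorffDist_le_of_mem_dist (by positivity)
    · exact one_side hr hu hΛ hrr hxx hA0 (by linarith) hp hp' e1 e2
    · exact one_side hr hu' hΛ hrr hxx hA0 (by linarith) hp' hp e3 e4
  · obtain ⟨w, hw, hw1, hw2⟩ := sign_choice hu hu'
    set q := p' + (inner ℝ u' (p - p') : ℝ) • u' with hq
    have hpq : ‖p - q‖ ≤ 24 * A := by
      have : p - q = Pj u' (p - p') := by rw [hq, Pj]; abel
      rw [this]
      exact e1
    have huw : ‖u - w‖ ≤ 128 * A / r := by
      have : 128 * A / r = 2 * (64 * A / r) := by ring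
      rw [this]
      linarith
    have hG := Gdiff hr hu hw1 hp (by linarith) hpq huw
    have hline : lineSet p' u' = lineSet q w := by
      have h1 : lineSet p' u' = lineSet q u' := line_base ⟨_, hq⟩
      rcases hw with rfl | rfl
      · exact h1
      · rw [h1, line_neg]
    have hcone := cone_adm x r
    have hinv : ∫ t : ℝ, cone x r (p' + t • u') = ∫ t : ℝ, cone x r (q + t • w) := by
      have h1 := lineInt p' u' hu' zero_le_one hcone.1.continuous
      have h2 := lineInt q w hw1 zero_le_one hcone.1.continuous
      rw [hline] at h1
      linarith
    rw [← hinv] at hG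
    have hcc := hνν _ hcone
    have hGl : (r / 4 - -(r / 4)) * (r / 4) ≤ ∫ t : ℝ, cone x r (p' + t • u') := by
      apply int_lower (adm_line_integrable hcone p' u' hu') (fun t => cone_nonneg _ _ _)
      · linarith
      · intro t ht
        have h3 := line_near (p := p') (x := x) (t := t) hu'
        have h4 : |t| ≤ r / 4 := abs_le.2 ht
        refine le_trans ?_ (le_max_left _ _)
        linarith
    set G := ∫ t : ℝ, cone x r (p + t • u)
    set G' := ∫ t : ℝ, cone x r (p' + t • u')
    have h1 : |c - c'| * (r ^ 2 / 8) ≤ 2 * D + (K * M / r) * (1120 * A * r) := by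
      calc |c - c'| * (r ^ 2 / 8) ≤ |c - c'| * G' := by
            gcongr
            linarith
        _ = |(c - c') * G'| := by
            rw [abs_mul, abs_of_nonneg (a := G')]
            have h0 : 0 ≤ (r / 4 - -(r / 4)) * (r / 4) := by
              apply mul_nonneg <;> linarith
            exact h0.trans hGl
        _ = |(c * G - c' * G') - c * (G - G')| := by congr 1; ring
        _ ≤ |c * G - c' * G'| + |c * (G - G')| := abs_sub _ _
        _ ≤ 2 * D + (K * M / r) * (1120 * A * r) := by
            rw [abs_mul, abs_of_nonneg hc]
            gcongr
    have h2 : 2 * D + (K * M / r) * (1120 * A * r) = (2 + 17920 * K * C₀) * α * M * r' := by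
      rw [hDdef, hAdef]
      field_simp
      ring
    rw [h2] at h1
    rw [le_div_iff₀ hr']
    have h3 : |c - c'| * r' * r ^ 2 ≤ (Λ ^ 2 * (16 + 143360 * K * C₀)) * α * M * r ^ 2 := by
      calc |c - c'| * r' * r ^ 2 = 8 * r' * (|c - c'| * (r ^ 2 / 8)) := by ring
        _ ≤ 8 * r' * ((2 + 17920 * K * C₀) * α * M * r') := by gcongr
        _ = (16 + 143360 * K * C₀) * α * M * r' ^ 2 := by ring
        _ ≤ (16 + 143360 * K * C₀) * α * M * (Λ * r) ^ 2 := by gcongr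
        _ = _ := by ring
    exact le_of_mul_le_mul_right h3 (by positivity)

theorem stmt13 {d : ℕ} (hd : 1 ≤ d) (C₀ Λ : ℝ) (hC₀ : 1 ≤ C₀) (hΛ : 1 ≤ Λ) :
    ∃ C : ℝ, 0 < C ∧
      ∀ μ : Measure (EuclideanSpace ℝ (Fin d)), IsLocallyFiniteMeasure μ →
      ∀ (x x' : EuclideanSpace ℝ (Fin d)) (r r' : ℝ), 0 < r → 0 < r' →
        ball x r ⊆ ball x' r' → r' ≤ Λ * r →
        0 < μ (ball x (r / 4)) →
        μ (ball x' r') ≤ ENNReal.ofReal C₀ * μ (ball x (r / 4)) →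
        μ (ball x' r') ≤ ENNReal.ofReal C₀ * μ (ball x' (r' / 4)) →
      ∀ (cB : ℝ) (LB : Set (EuclideanSpace ℝ (Fin d))),
        0 ≤ cB → IsLine LB → (LB ∩ closedBall x r).Nonempty →
        distB (ball x r) μ ((ENNReal.ofReal cB) • (μH[1].restrict LB)) =
          alphaMu μ (ball x r) r * r * (μ (ball x r)).toReal →
      ∀ (cB' : ℝ) (LB' : Set (EuclideanSpace ℝ (Fin d))),
        0 ≤ cB' → IsLine LB' → (LB' ∩ closedBall x' r').Nonempty →
        distB (ball x' r') μ ((ENNReal.ofReal cB') • (μH[1].restrict LB')) =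
          alphaMu μ (ball x' r') r' * r' * (μ (ball x' r')).toReal →
        hausdorffDist (LB ∩ closedBall x' r') (LB' ∩ closedBall x' r') ≤
            C * alphaMu μ (ball x' r') r' * r' ∧
          |cB - cB'| ≤ C * alphaMu μ (ball x' r') r' * (μ (ball x' r')).toReal / r' := by
  obtain ⟨K, hK, hdens⟩ := dens_upper hd hC₀
  set E : ℝ := 8000 * Λ ^ 2 * C₀ with hE
  have hE0 : 0 < E := by positivity
  set C1 : ℝ := 17024 * Λ ^ 2 * C₀ with hC1
  set C2 : ℝ := Λ ^ 2 * (16 + 143360 * K * C₀) with hC2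
  have hC1' : 0 < C1 := by positivity
  have hC2' : 0 < C2 := by positivity
  refine ⟨2 * E + 2 * K * Λ * E + C1 + C2, by positivity, ?_⟩
  intro μ hμ x x' r r' hr hr' hsub hrr hpos hd1 hd2 cB LB hcB hLB hne hopt cB' LB' hcB' hLB' hne' hopt'
  have hxx := ball_incl hd hr hsub
  change distB (ball x r) μ (lm cB LB) = _ at hopt
  change distB (ball x' r') μ (lm cB' LB') = _ at hopt'
  have hC₀' : 0 ≤ C₀ := by linarith
  set m := (μ (ball x (r / 4))).toReal with hm
  have hm0 : 0 < m := ENNReal.toReal_pos hpos.ne' measure_ball_lt_top.ne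
  have hMm : (μ (ball x' r')).toReal ≤ C₀ * m := by
    have := ENNReal.toReal_mono (ENNReal.mul_ne_top ENNReal.ofReal_ne_top measure_ball_lt_top.ne) hd1
    rwa [ENNReal.toReal_mul, ENNReal.toReal_ofReal hC₀'] at this
  have hMm' : (μ (ball x' r')).toReal ≤ C₀ * (μ (ball x' (r' / 4))).toReal := by
    have := ENNReal.toReal_mono (ENNReal.mul_ne_top ENNReal.ofReal_ne_top measure_ball_lt_top.ne) hd2
    rwa [ENNReal.toReal_mul, ENNReal.toReal_ofReal hC₀'] at this
  have hmB : m ≤ (μ (ball x r)).toReal :=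
    ENNReal.toReal_mono measure_ball_lt_top.ne (measure_mono (ball_subset_ball (by linarith)))
  have hBM : (μ (ball x r)).toReal ≤ (μ (ball x' r')).toReal :=
    ENNReal.toReal_mono measure_ball_lt_top.ne (measure_mono hsub)
  set M := (μ (ball x' r')).toReal with hM
  have hB0 : 0 < (μ (ball x r)).toReal := by linarith
  have hM0 : 0 < M := by linarith
  have hα0 := alpha_nonneg μ (ball x' r') hr'
  set α := alphaMu μ (ball x' r') r' with hα
  have hmin : ∀ c' L', 0 ≤ c' → IsLine L' →
      distB (ball x r) μ (lm cB LB) ≤ distB (ball x r) μ (lm c' L') := by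
    intro c' L' h1 h2
    rw [hopt]
    exact alpha_le μ hr hB0 h1 h2
  have hmin' : ∀ c' L', 0 ≤ c' → IsLine L' →
      distB (ball x' r') μ (lm cB' LB') ≤ distB (ball x' r') μ (lm c' L') := by
    intro c' L' h1 h2
    rw [hopt']
    exact alpha_le μ hr' hM0 h1 h2
  have hu : cB ≤ K * M / r := by
    refine (hdens μ x r hr hB0 (hBM.trans hMm) cB LB hcB hLB hmin).trans ?_
    gcongr
  have hu' : cB' ≤ K * M / r' := hdens μ x' r' hr' hM0 hMm' cB' LB' hcB' hLB' hmin'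
  by_cases hsmall : α ≤ 1 / E
  · have hν' : ∀ f, Adm x r f → |(∫ y, f y ∂μ) - ∫ y, f y ∂(lm cB' LB')| ≤ α * r' * M := by
      intro f hf
      rw [← hopt']
      exact le_distB_s13 hd μ hr' hcB' hLB' (adm_mono hf hsub)
    have hν : ∀ f, Adm x r f → |(∫ y, f y ∂μ) - ∫ y, f y ∂(lm cB LB)| ≤ α * r' * M := by
      intro f hf
      refine (le_distB_s13 hd μ hr hcB hLB hf).trans ?_
      exact (hmin cB' LB' hcB' hLB').trans (distB_le _ _ hν')
    obtain ⟨h1, h2⟩ := small_case hd hC₀ hΛ hK hα0 hsmall μ hr hr' hxx hrr hm hm0 hMm hM0 hcB hcB'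
      hLB hLB' hν hν' hu
    constructor
    · refine h1.trans ?_
      gcongr
      have : 0 < 2 * E + 2 * K * Λ * E := by positivity
      linarith
    · refine h2.trans ?_
      gcongr
      have : 0 < 2 * E + 2 * K * Λ * E + C1 := by positivity
      linarith
  · push Not at hsmall
    have hEα : 1 ≤ E * α := by
      rw [div_lt_iff₀ hE0] at hsmall
      linarith
    constructor
    · have h1 : hausdorffDist (LB ∩ closedBall x' r') (LB' ∩ closedBall x' r') ≤ 2 * r' := by
        have n1 : (LB ∩ closedBall x' r').Nonempty :=
          hne.mono (Set.inter_subset_inter_right _ (closedBall_subset_closedBall' (by linarith)))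
        obtain ⟨a, ha⟩ := n1
        obtain ⟨b, hb⟩ := hne'
        have key : ∀ y z : EE d, y ∈ closedBall x' r' → z ∈ closedBall x' r' → dist y z ≤ 2 * r' := by
          intro y z hy hz
          rw [mem_closedBall] at hy hz
          linarith [dist_triangle_right y z x']
        apply hausdorffDist_le_of_mem_dist (by positivity)
        · intro y hy
          exact ⟨b, hb, key _ _ hy.2 hb.2⟩
        · intro y hy
          exact ⟨a, ha, key _ _ hy.2 ha.2⟩
      calc _ ≤ 2 * r' := h1
        _ ≤ 2 * (E * α) * r' := by nlinarith
        _ = (2 * E) * α * r' := by ring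
        _ ≤ _ := by
          gcongr
          have : 0 < 2 * K * Λ * E := by positivity
          linarith
    · have h1 : K * M / r ≤ K * M * Λ / r' := by
        rw [div_le_div_iff₀ hr hr']
        have : 0 < K * M := by positivity
        nlinarith
      have h2 : K * M / r' ≤ K * M * Λ / r' := by
        apply div_le_div_of_nonneg_right _ hr'.le
        exact le_mul_of_one_le_right (by positivity) hΛ
      have h3 : |cB - cB'| ≤ 2 * K * Λ * M / r' := by
        have h4 : 2 * K * Λ * M / r' = K * M * Λ / r' + K * M * Λ / r' := by ring
        rw [h4, abs_le]
        constructor <;> linarith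
      refine h3.trans ?_
      apply div_le_div_of_nonneg_right _ hr'.le
      apply mul_le_mul_of_nonneg_right _ hM0.le
      calc 2 * K * Λ ≤ 2 * K * Λ * (E * α) := le_mul_of_one_le_right (by positivity) hEα
        _ = (2 * K * Λ * E) * α := by ring
        _ ≤ _ := by
          apply mul_le_mul_of_nonneg_right _ hα0
          linarith
end
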